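/- Let K = [-1,1]^n be equipped with the Lebesgue measure (weight w ≡ 1) and let f be an n-variate real polynomial. Then there exists a constant c > 0 (depending only on n and f) such that for every integer r ≥ 1 one has E^{(r)}_K(f) ≤ c / r^2. -/

import Mathlib

open MeasureTheory

noncomputable section

/-- A polynomial is a sum of squares. -/
def IsSOS {n : ℕ} (q : MvPolynomial (Fin n) ℝ) : Prop :=
  ∃ (m : ℕ) (p : Fin m → MvPolynomial (Fin n) ℝ), q = ∑ i, p i ^ 2

/-- The Lasserre measure-based upper bound `f^{(r)}_{K,w}`: the infimum of
`∫_K f q w dx` over sum-of-squares polynomials `q` of degree at most `2r`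
with `∫_K q w dx = 1`. -/
noncomputable def lasserre {n : ℕ} (r : ℕ) (K : Set (EuclideanSpace ℝ (Fin n)))
    (w f : EuclideanSpace ℝ (Fin n) → ℝ) : ℝ :=
  sInf { v : ℝ | ∃ q : MvPolynomial (Fin n) ℝ, IsSOS q ∧ q.totalDegree ≤ 2 * r ∧
    (∫ x in K, MvPolynomial.eval (fun i => x i) q * w x) = 1 ∧
    v = ∫ x in K, f x * MvPolynomial.eval (fun i => x i) q * w x }

/-- The error `E^{(r)}_{K,w}(f) = f^{(r)}_{K,w} - min_{x ∈ K} f(x)`. -/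
noncomputable def lasserreError {n : ℕ} (r : ℕ) (K : Set (EuclideanSpace ℝ (Fin n)))
    (w f : EuclideanSpace ℝ (Fin n) → ℝ) : ℝ :=
  lasserre r K w f - sInf (f '' K)


/-- The Legendre polynomials, defined by Bonnet's recurrence. -/
def legendre : ℕ → Polynomial ℝ
  | 0 => 1
  | 1 => Polynomial.X
  | k + 2 => Polynomial.C (((2 * k + 3 : ℝ)) / (k + 2)) * (Polynomial.X * legendre (k + 1)) -
      Polynomial.C ((k + 1 : ℝ) / (k + 2)) * legendre k

lemma legendre_add_two (k : ℕ) : legendre (k + 2) =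
    Polynomial.C (((2 * k + 3 : ℝ)) / (k + 2)) * (Polynomial.X * legendre (k + 1)) -
      Polynomial.C ((k + 1 : ℝ) / (k + 2)) * legendre k := by
  rw [legendre]

lemma natDegree_legendre_le (k : ℕ) : (legendre k).natDegree ≤ k := by
  induction k using Nat.strong_induction_on with
  | _ k ih =>
    match k with
    | 0 => simp [legendre]
    | 1 => simp [legendre]
    | k + 2 =>
      rw [legendre_add_two]
      refine (Polynomial.natDegree_sub_le _ _).trans (max_le ?_ ?_)
      · refine (Polynomial.natDegree_C_mul_le _ _).trans ?_
        refine Polynomial.natDegree_mul_le.trans ?_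
        have := ih (k + 1) (by omega)
        rw [Polynomial.natDegree_X]
        omega
      · refine (Polynomial.natDegree_C_mul_le _ _).trans ?_
        have := ih k (by omega)
        omega

/-- Bonnet's recurrence, evaluated at a point. -/
lemma eval_legendre_add_two (k : ℕ) (x : ℝ) :
    (k + 2 : ℝ) * (legendre (k + 2)).eval x =
      (2 * k + 3) * (x * (legendre (k + 1)).eval x) - (k + 1) * (legendre k).eval x := by
  have h : (k + 2 : ℝ) ≠ 0 := by positivity
  rw [legendre_add_two]
  simp only [Polynomial.eval_sub, Polynomial.eval_mul, Polynomial.eval_C, Polynomial.eval_X]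
  field_simp

lemma eval_derivative_legendre_add_two (k : ℕ) (x : ℝ) :
    (k + 2 : ℝ) * (legendre (k + 2)).derivative.eval x =
      (2 * k + 3) * ((legendre (k + 1)).eval x + x * (legendre (k + 1)).derivative.eval x) -
        (k + 1) * (legendre k).derivative.eval x := by
  have h : (k + 2 : ℝ) ≠ 0 := by positivity
  rw [legendre_add_two]
  simp only [Polynomial.derivative_sub, Polynomial.derivative_mul, Polynomial.derivative_C,
    Polynomial.derivative_X, Polynomial.eval_sub, Polynomial.eval_mul, Polynomial.eval_C,
    Polynomial.eval_X, Polynomial.eval_add, Polynomial.eval_one, Polynomial.eval_zero]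
  field_simp
  ring

lemma eval_derivative_legendre_succ (k : ℕ) (x : ℝ) :
    (legendre (k + 1)).derivative.eval x - x * (legendre k).derivative.eval x =
        (k + 1) * (legendre k).eval x ∧
      x * (legendre (k + 1)).derivative.eval x - (legendre k).derivative.eval x =
        (k + 1) * (legendre (k + 1)).eval x := by
  induction k with
  | zero => simp [legendre]
  | succ k ih =>
    obtain ⟨hA, hB⟩ := ih
    have h : (k + 2 : ℝ) ≠ 0 := by positivity
    have h1 := eval_legendre_add_two k x
    have h2 := eval_derivative_legendre_add_two k x
    have hA' : (legendre (k + 2)).derivative.eval x -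
        x * (legendre (k + 1)).derivative.eval x = (k + 2) * (legendre (k + 1)).eval x := by
      apply mul_left_cancel₀ h
      linear_combination h2 + (k + 1 : ℝ) * hB
    push_cast
    refine ⟨by linear_combination hA', ?_⟩
    linear_combination x * hA' - h1 - hA + x * hB

/-- Legendre's differential equation. -/
lemma derivative_one_sub_sq_mul_derivative_legendre (k : ℕ) :
    ((1 - Polynomial.X ^ 2) * (legendre k).derivative).derivative =
      Polynomial.C (-(k * (k + 1) : ℝ)) * legendre k := by
  cases k with
  | zero => simp [legendre]
  | succ k =>
    have h : (1 - Polynomial.X ^ 2) * (legendre (k + 1)).derivative =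
        Polynomial.C (k + 1 : ℝ) * (legendre k - Polynomial.X * legendre (k + 1)) := by
      refine Polynomial.funext fun x => ?_
      obtain ⟨hA, hB⟩ := eval_derivative_legendre_succ k x
      simp only [Polynomial.eval_mul, Polynomial.eval_sub, Polynomial.eval_one,
        Polynomial.eval_pow, Polynomial.eval_X, Polynomial.eval_C]
      linear_combination hA - x * hB
    rw [h]
    refine Polynomial.funext fun x => ?_
    obtain ⟨hA, hB⟩ := eval_derivative_legendre_succ k x
    simp only [Polynomial.derivative_mul, Polynomial.derivative_sub, Polynomial.derivative_C,
      Polynomial.derivative_X, Polynomial.eval_mul, Polynomial.eval_sub, Polynomial.eval_add,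
      Polynomial.eval_one, Polynomial.eval_zero, Polynomial.eval_X, Polynomial.eval_C]
    push_cast
    linear_combination -(k + 1 : ℝ) * hB

/-- Integration over `[-1, 1]` as a linear functional on polynomials. -/
def polyIntegral : Polynomial ℝ →ₗ[ℝ] ℝ where
  toFun p := ∫ x in (-1 : ℝ)..1, p.eval x
  map_add' p q := by
    simp only [Polynomial.eval_add]
    exact intervalIntegral.integral_add (p.continuous.intervalIntegrable _ _)
      (q.continuous.intervalIntegrable _ _)
  map_smul' c p := by
    simp [Polynomial.eval_smul]

lemma polyIntegral_apply (p : Polynomial ℝ) :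
    polyIntegral p = ∫ x in (-1 : ℝ)..1, p.eval x := rfl

lemma polyIntegral_C_mul (c : ℝ) (p : Polynomial ℝ) :
    polyIntegral (Polynomial.C c * p) = c * polyIntegral p := by
  rw [← Polynomial.smul_eq_C_mul, map_smul, smul_eq_mul]

lemma polyIntegral_derivative (p : Polynomial ℝ) :
    polyIntegral p.derivative = p.eval 1 - p.eval (-1) :=
  intervalIntegral.integral_eq_sub_of_hasDerivAt (fun x _ => p.hasDerivAt x)
    (p.derivative.continuous.intervalIntegrable _ _)

lemma polyIntegral_legendre_mul_of_ne {j k : ℕ} (hjk : j ≠ k) :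
    polyIntegral (legendre j * legendre k) = 0 := by
  have hW := polyIntegral_derivative
    ((1 - Polynomial.X ^ 2) * (legendre k).derivative * legendre j -
      (1 - Polynomial.X ^ 2) * (legendre j).derivative * legendre k)
  have hD : ((1 - Polynomial.X ^ 2) * (legendre k).derivative * legendre j -
      (1 - Polynomial.X ^ 2) * (legendre j).derivative * legendre k).derivative =
      Polynomial.C (j * (j + 1) - k * (k + 1) : ℝ) * (legendre j * legendre k) := by
    rw [Polynomial.derivative_sub, Polynomial.derivative_mul (g := legendre j),
      Polynomial.derivative_mul (g := legendre k),
      derivative_one_sub_sq_mul_derivative_legendre,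
      derivative_one_sub_sq_mul_derivative_legendre]
    simp only [map_neg, map_sub]
    ring
  rw [hD, polyIntegral_C_mul] at hW
  have hne : (j * (j + 1) - k * (k + 1) : ℝ) ≠ 0 := by
    have h1 : (j * (j + 1) - k * (k + 1) : ℝ) = (j - k) * (j + k + 1) := by ring
    rw [h1]
    refine mul_ne_zero (sub_ne_zero.2 (by exact_mod_cast hjk)) (by positivity)
  refine (mul_eq_zero.1 (hW.trans ?_)).resolve_left hne
  simp

/-- Bonnet's recurrence as an identity of polynomials. -/
lemma X_mul_legendre_succ (k : ℕ) :
    Polynomial.C (2 * k + 3 : ℝ) * (Polynomial.X * legendre (k + 1)) =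
      Polynomial.C (k + 2 : ℝ) * legendre (k + 2) + Polynomial.C (k + 1 : ℝ) * legendre k := by
  refine Polynomial.funext fun x => ?_
  have := eval_legendre_add_two k x
  simp only [Polynomial.eval_mul, Polynomial.eval_add, Polynomial.eval_X, Polynomial.eval_C]
  linear_combination -this

lemma polyIntegral_legendre_mul_self (k : ℕ) :
    polyIntegral (legendre k * legendre k) = 1 / (k + 1 / 2) := by
  induction k with
  | zero => norm_num [legendre, polyIntegral_apply]
  | succ k ih =>
    have h1 : (2 * k + 3 : ℝ) * polyIntegral (Polynomial.X * legendre (k + 1) * legendre k) =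
        (k + 1) * polyIntegral (legendre k * legendre k) := by
      rw [← polyIntegral_C_mul, ← mul_assoc, X_mul_legendre_succ, add_mul, map_add, mul_assoc,
        mul_assoc, polyIntegral_C_mul, polyIntegral_C_mul,
        polyIntegral_legendre_mul_of_ne (by omega : k + 2 ≠ k)]
      ring
    have h2 : (2 * k + 1 : ℝ) * polyIntegral (Polynomial.X * legendre (k + 1) * legendre k) =
        (k + 1) * polyIntegral (legendre (k + 1) * legendre (k + 1)) := by
      cases k with
      | zero => simp [legendre]
      | succ k =>
        have e : Polynomial.C (2 * ((k + 1 : ℕ) : ℝ) + 1) *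
            (Polynomial.X * legendre (k + 1 + 1) * legendre (k + 1)) =
            Polynomial.C (2 * k + 3 : ℝ) * (Polynomial.X * legendre (k + 1)) *
              legendre (k + 2) := by
          have : (2 * ((k + 1 : ℕ) : ℝ) + 1) = 2 * k + 3 := by push_cast; ring
          rw [this]
          ring
        rw [← polyIntegral_C_mul, e, X_mul_legendre_succ, add_mul, map_add, mul_assoc,
          mul_assoc, polyIntegral_C_mul, polyIntegral_C_mul,
          polyIntegral_legendre_mul_of_ne (by omega : k ≠ k + 2)]
        push_cast
        ring
    rw [ih] at h1
    have h3 : (k + 1 : ℝ) ≠ 0 := by positivity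
    have h4 : (2 * k + 1 : ℝ) ≠ 0 := by positivity
    have h5 : (2 * k + 3 : ℝ) ≠ 0 := by positivity
    have h6 : (k + 1 + 1 / 2 : ℝ) ≠ 0 := by positivity
    have h7 : (k + 1 / 2 : ℝ) ≠ 0 := by positivity
    have h8 : (k + 1 / 2 : ℝ) * (1 / (k + 1 / 2)) = 1 := by field_simp
    push_cast
    rw [eq_div_iff h6]
    apply mul_left_cancel₀ h3
    linear_combination -(k + 1 + 1 / 2 : ℝ) * h2 + (k + 1 / 2 : ℝ) * h1 + (k + 1 : ℝ) * h8

lemma polyIntegral_sum_mul_sum (M : ℕ) (b c : ℕ → ℝ) :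
    polyIntegral ((∑ k ∈ Finset.range M, Polynomial.C (b k) * legendre k) *
      ∑ k ∈ Finset.range M, Polynomial.C (c k) * legendre k) =
      ∑ k ∈ Finset.range M, b k * c k / (k + 1 / 2) := by
  rw [Finset.sum_mul_sum, map_sum]
  refine Finset.sum_congr rfl fun j hj => ?_
  rw [map_sum, Finset.sum_eq_single j]
  · rw [mul_mul_mul_comm, ← map_mul, polyIntegral_C_mul, polyIntegral_legendre_mul_self]
    ring
  · intro k _ hk
    rw [mul_mul_mul_comm, ← map_mul, polyIntegral_C_mul,
      polyIntegral_legendre_mul_of_ne (Ne.symm hk), mul_zero]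
  · exact fun h => absurd hj h

lemma X_mul_sum_legendre (v : ℝ → ℝ) (M : ℕ) :
    Polynomial.X * ∑ k ∈ Finset.range M, Polynomial.C ((k + 1 / 2) * v k) * legendre k =
      (∑ k ∈ Finset.range M,
        Polynomial.C (k / 2 * v (k - 1) + (k + 1) / 2 * v (k + 1)) * legendre k) -
        Polynomial.C (M / 2 * v M) * legendre (M - 1) +
        Polynomial.C (M / 2 * v (M - 1)) * legendre M := by
  induction M with
  | zero => simp
  | succ M ih =>
    rw [Finset.sum_range_succ, Finset.sum_range_succ, mul_add, ih]
    cases M with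
    | zero =>
      refine Polynomial.funext fun x => ?_
      simp [legendre]
      ring
    | succ k =>
      refine Polynomial.funext fun x => ?_
      have h := eval_legendre_add_two k x
      simp only [Polynomial.eval_mul, Polynomial.eval_add, Polynomial.eval_sub,
        Polynomial.eval_X, Polynomial.eval_C, Nat.add_sub_cancel, Nat.cast_add, Nat.cast_one,
        add_sub_cancel_right]
      rw [show (k + 1 + 1 : ℝ) = k + 2 by ring]
      linear_combination -(1 / 2 * v (k + 1)) * h

lemma X_sub_C_mul_sum_legendre (a : ℝ) (v : ℝ → ℝ) (N : ℕ) (hN : v N = 0)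
    (hN' : v (N + 1) = 0) :
    (Polynomial.X - Polynomial.C a) *
        ∑ k ∈ Finset.range (N + 1), Polynomial.C ((k + 1 / 2) * v k) * legendre k =
      ∑ k ∈ Finset.range (N + 1), Polynomial.C
        (k / 2 * v (k - 1) + (k + 1) / 2 * v (k + 1) - a * ((k + 1 / 2) * v k)) * legendre k := by
  have h1 : v ((N + 1 : ℕ) : ℝ) = 0 := by exact_mod_cast hN'
  have h2 : v (((N + 1 : ℕ) : ℝ) - 1) = 0 := by
    rw [Nat.cast_add, Nat.cast_one, add_sub_cancel_right, hN]
  rw [sub_mul, X_mul_sum_legendre, h1, h2, mul_zero, map_zero, zero_mul, zero_mul, sub_zero,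
    add_zero, Finset.mul_sum, ← Finset.sum_sub_distrib]
  refine Finset.sum_congr rfl fun k _ => ?_
  rw [map_sub, sub_mul, map_mul _ a, mul_assoc]

/-- The sequence of coefficients, up to the phase and the Legendre weight, of the kernels. -/
def kernelCoeff (N x : ℝ) : ℝ := x * (N - x) * (N + 1 - x)

/-- The in-phase part of the action of `X - cos α` on the kernel coefficients. -/
def kernelEven (N x : ℝ) : ℝ :=
  x / 2 * kernelCoeff N (x - 1) + (x + 1) / 2 * kernelCoeff N (x + 1) -
    (x + 1 / 2) * kernelCoeff N x

/-- The out-of-phase part of the action of `X - cos α` on the kernel coefficients. -/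
def kernelOdd (N x : ℝ) : ℝ :=
  x / 2 * kernelCoeff N (x - 1) - (x + 1) / 2 * kernelCoeff N (x + 1)

lemma kernelCoeff_nonneg {N x : ℝ} (hx : 0 ≤ x) (hxN : x ≤ N) : 0 ≤ kernelCoeff N x :=
  mul_nonneg (mul_nonneg hx (by linarith)) (by linarith)

lemma kernelCoeff_le {m x : ℝ} (hm : 1 ≤ m) (hx : 0 ≤ x) (hxN : x ≤ 3 * m) :
    kernelCoeff (3 * m) x ≤ 36 * m ^ 3 := by
  calc x * (3 * m - x) * (3 * m + 1 - x) ≤ (3 * m) * (3 * m) * (4 * m) := by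
        have h1 : 0 ≤ 3 * m - x := by linarith
        have h2 : 0 ≤ 3 * m + 1 - x := by linarith
        gcongr <;> linarith
    _ = 36 * m ^ 3 := by ring

lemma pow_le_kernelCoeff {m x : ℝ} (hm : 1 ≤ m) (hx : m ≤ x) (hxN : x ≤ 2 * m) :
    m ^ 3 ≤ kernelCoeff (3 * m) x := by
  calc m ^ 3 = m * m * m := by ring
    _ ≤ x * (3 * m - x) * (3 * m + 1 - x) := by
        have h1 : m ≤ 3 * m - x := by linarith
        have h2 : m ≤ 3 * m + 1 - x := by linarith
        have h3 : 0 ≤ 3 * m - x := by linarith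
        have h4 : 0 ≤ x := by linarith
        have h5 : 0 ≤ x * (3 * m - x) := by positivity
        gcongr

lemma abs_kernelEven_le {m x : ℝ} (hm : 1 ≤ m) (hx : 0 ≤ x) (hxN : x ≤ 3 * m) :
    |kernelEven (3 * m) x| ≤ 60 * m ^ 2 := by
  have e : kernelEven (3 * m) x = (9 * x ^ 2 + 3 * x + 1 - (6 * m + 1) * (4 * x + 1) +
      3 * m * (3 * m + 1)) / 2 := by
    simp only [kernelEven, kernelCoeff]
    ring
  have h1 : x * m ≤ 3 * m * m := by gcongr
  have h2 : x ^ 2 ≤ (3 * m) ^ 2 := by gcongr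
  have h3 : m ≤ m ^ 2 := by nlinarith
  have h4 : 0 ≤ x * m := by positivity
  rw [e, abs_le]
  constructor <;> nlinarith

lemma abs_kernelOdd_le {m x : ℝ} (hm : 1 ≤ m) (hx : 0 ≤ x) (hxN : x ≤ 3 * m) :
    |kernelOdd (3 * m) x| ≤ 108 * m ^ 2 * (x + 1) := by
  have e : kernelOdd (3 * m) x = ((6 * m + 1) * (5 * x ^ 2 + 2 * x + 1) -
      (7 * x ^ 3 + 3 * x ^ 2 + 5 * x + 1) - 3 * m * (3 * m + 1) * (3 * x + 1)) / 2 := by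
    simp only [kernelOdd, kernelCoeff]
    ring
  have h0 : 1 ≤ m ^ 2 := by nlinarith
  have h2 : x ^ 2 ≤ (3 * m) ^ 2 := by gcongr
  have b1 : (6 * m + 1) * (5 * x ^ 2 + 2 * x + 1) ≤ 112 * m ^ 2 * (x + 1) :=
    calc (6 * m + 1) * (5 * x ^ 2 + 2 * x + 1) ≤ (7 * m) * ((16 * m) * (x + 1)) := by
          gcongr
          · linarith
          · nlinarith
      _ = _ := by ring
  have b2 : 7 * x ^ 3 + 3 * x ^ 2 + 5 * x + 1 ≤ 68 * m ^ 2 * (x + 1) :=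
    calc 7 * x ^ 3 + 3 * x ^ 2 + 5 * x + 1 ≤ (7 * x ^ 2 + 5) * (x + 1) := by nlinarith
      _ ≤ 68 * m ^ 2 * (x + 1) := by
          gcongr
          nlinarith
  have b3 : 3 * m * (3 * m + 1) * (3 * x + 1) ≤ 36 * m ^ 2 * (x + 1) :=
    calc 3 * m * (3 * m + 1) * (3 * x + 1) ≤ 3 * m * (4 * m) * (3 * (x + 1)) := by
          gcongr <;> linarith
      _ = _ := by ring
  have p1 : 0 ≤ (6 * m + 1) * (5 * x ^ 2 + 2 * x + 1) := by positivity
  have p2 : 0 ≤ 7 * x ^ 3 + 3 * x ^ 2 + 5 * x + 1 := by positivity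
  have p3 : 0 ≤ 3 * m * (3 * m + 1) * (3 * x + 1) := by positivity
  rw [e, abs_le]
  constructor <;> linarith

/-- The Legendre expansion with coefficients `kernelCoeff`, modulated by `t`. -/
def kernelPoly (N : ℕ) (t : ℝ → ℝ) : Polynomial ℝ :=
  ∑ k ∈ Finset.range (N + 1), Polynomial.C ((k + 1 / 2) * (kernelCoeff N k * t k)) * legendre k

lemma natDegree_kernelPoly_le (N : ℕ) (t : ℝ → ℝ) : (kernelPoly N t).natDegree ≤ N := by
  refine Polynomial.natDegree_sum_le_of_forall_le _ _ fun k hk => ?_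
  have := Finset.mem_range.1 hk
  exact (Polynomial.natDegree_C_mul_le _ _).trans ((natDegree_legendre_le k).trans (by omega))

lemma X_sub_C_mul_kernelPoly (a : ℝ) (N : ℕ) (t : ℝ → ℝ) :
    (Polynomial.X - Polynomial.C a) * kernelPoly N t =
      ∑ k ∈ Finset.range (N + 1), Polynomial.C
        (k / 2 * (kernelCoeff N (k - 1) * t (k - 1)) +
          (k + 1) / 2 * (kernelCoeff N (k + 1) * t (k + 1)) -
          a * ((k + 1 / 2) * (kernelCoeff N k * t k))) * legendre k :=
  X_sub_C_mul_sum_legendre a (fun x => kernelCoeff N x * t x) N (by simp [kernelCoeff])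
    (by simp [kernelCoeff])

lemma X_sub_C_mul_kernelPoly_cos (α : ℝ) (N : ℕ) :
    (Polynomial.X - Polynomial.C (Real.cos α)) * kernelPoly N (fun x => Real.cos (x * α)) =
      ∑ k ∈ Finset.range (N + 1), Polynomial.C
        (Real.cos α * Real.cos (k * α) * kernelEven N k +
          Real.sin α * Real.sin (k * α) * kernelOdd N k) * legendre k := by
  rw [X_sub_C_mul_kernelPoly]
  refine Finset.sum_congr rfl fun k _ => ?_
  congr 2
  rw [sub_mul, add_mul, one_mul, Real.cos_sub, Real.cos_add, kernelEven, kernelOdd]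
  ring

lemma X_sub_C_mul_kernelPoly_sin (α : ℝ) (N : ℕ) :
    (Polynomial.X - Polynomial.C (Real.cos α)) * kernelPoly N (fun x => Real.sin (x * α)) =
      ∑ k ∈ Finset.range (N + 1), Polynomial.C
        (Real.cos α * Real.sin (k * α) * kernelEven N k -
          Real.sin α * Real.cos (k * α) * kernelOdd N k) * legendre k := by
  rw [X_sub_C_mul_kernelPoly]
  refine Finset.sum_congr rfl fun k _ => ?_
  congr 2
  rw [sub_mul, add_mul, one_mul, Real.sin_sub, Real.sin_add, kernelEven, kernelOdd]
  ring

/-- The unnormalised kernel concentrated at `cos α`. -/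
def kernel (N : ℕ) (α : ℝ) : Polynomial ℝ :=
  kernelPoly N (fun x => Real.cos (x * α)) * kernelPoly N (fun x => Real.cos (x * α)) +
    kernelPoly N (fun x => Real.sin (x * α)) * kernelPoly N (fun x => Real.sin (x * α))

lemma polyIntegral_kernel (N : ℕ) (α : ℝ) :
    polyIntegral (kernel N α) =
      ∑ k ∈ Finset.range (N + 1), (k + 1 / 2) * kernelCoeff N k ^ 2 := by
  rw [kernel, map_add, kernelPoly, kernelPoly, polyIntegral_sum_mul_sum,
    polyIntegral_sum_mul_sum, ← Finset.sum_add_distrib]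
  refine Finset.sum_congr rfl fun k _ => ?_
  have h : (k + 1 / 2 : ℝ) ≠ 0 := by positivity
  rw [← add_div, div_eq_iff h]
  linear_combination ((k + 1 / 2) ^ 2 * kernelCoeff N k ^ 2) * Real.cos_sq_add_sin_sq (k * α)

lemma polyIntegral_X_sub_C_mul_kernel (N : ℕ) (α : ℝ) :
    polyIntegral ((Polynomial.X - Polynomial.C (Real.cos α)) * kernel N α) =
      Real.cos α * ∑ k ∈ Finset.range (N + 1), kernelCoeff N k * kernelEven N k := by
  rw [kernel, mul_add, ← mul_assoc, ← mul_assoc, X_sub_C_mul_kernelPoly_cos,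
    X_sub_C_mul_kernelPoly_sin, map_add, kernelPoly, kernelPoly, polyIntegral_sum_mul_sum,
    polyIntegral_sum_mul_sum, ← Finset.sum_add_distrib, Finset.mul_sum]
  refine Finset.sum_congr rfl fun k _ => ?_
  have h : (k + 1 / 2 : ℝ) ≠ 0 := by positivity
  rw [← add_div, div_eq_iff h]
  linear_combination (Real.cos α * (k + 1 / 2) * kernelCoeff N k * kernelEven N k) *
    Real.cos_sq_add_sin_sq (k * α)

lemma polyIntegral_X_sub_C_sq_mul_kernel (N : ℕ) (α : ℝ) :
    polyIntegral ((Polynomial.X - Polynomial.C (Real.cos α)) ^ 2 * kernel N α) =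
      ∑ k ∈ Finset.range (N + 1), (Real.cos α ^ 2 * kernelEven N k ^ 2 +
        Real.sin α ^ 2 * kernelOdd N k ^ 2) / (k + 1 / 2) := by
  rw [kernel, mul_add, ← sq, ← sq, ← mul_pow, ← mul_pow, X_sub_C_mul_kernelPoly_cos,
    X_sub_C_mul_kernelPoly_sin, map_add, sq, sq, polyIntegral_sum_mul_sum,
    polyIntegral_sum_mul_sum, ← Finset.sum_add_distrib]
  refine Finset.sum_congr rfl fun k _ => ?_
  rw [← add_div]
  congr 1
  linear_combination (Real.cos α ^ 2 * kernelEven N k ^ 2 +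
    Real.sin α ^ 2 * kernelOdd N k ^ 2) * Real.cos_sq_add_sin_sq (k * α)

lemma le_polyIntegral_kernel {m : ℕ} (hm : 1 ≤ m) (α : ℝ) :
    (m : ℝ) ^ 8 ≤ polyIntegral (kernel (3 * m) α) := by
  have hm' : (1 : ℝ) ≤ m := by exact_mod_cast hm
  rw [polyIntegral_kernel]
  calc (m : ℝ) ^ 8 = ∑ k ∈ Finset.Ico m (2 * m), (m : ℝ) * ((m : ℝ) ^ 3) ^ 2 := by
        rw [Finset.sum_const, Nat.card_Ico, nsmul_eq_mul, two_mul, Nat.add_sub_cancel]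
        ring
    _ ≤ ∑ k ∈ Finset.Ico m (2 * m), ((k : ℝ) + 1 / 2) * kernelCoeff (3 * m : ℕ) k ^ 2 := by
        refine Finset.sum_le_sum fun k hk => ?_
        obtain ⟨h1, h2⟩ := Finset.mem_Ico.1 hk
        have h1' : (m : ℝ) ≤ k := by exact_mod_cast h1
        have h2' : (k : ℝ) ≤ 2 * m := by exact_mod_cast h2.le
        have := pow_le_kernelCoeff hm' h1' h2'
        push_cast
        gcongr
        linarith
    _ ≤ _ := by
        refine Finset.sum_le_sum_of_subset_of_nonneg (fun k hk => ?_) fun k _ _ => by positivity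
        have := Finset.mem_Ico.1 hk
        exact Finset.mem_range.2 (by omega)

lemma sum_range_le_of_forall_le {m : ℕ} (hm : 1 ≤ m) {g : ℕ → ℝ} {B : ℝ} (hB : 0 ≤ B)
    (hg : ∀ k : ℕ, (k : ℝ) ≤ 3 * m → g k ≤ B) :
    ∑ k ∈ Finset.range (3 * m + 1), g k ≤ 4 * m * B := by
  have hm' : (1 : ℝ) ≤ m := by exact_mod_cast hm
  refine (Finset.sum_le_card_nsmul _ _ B fun k hk => hg k ?_).trans ?_
  · have := Finset.mem_range.1 hk
    exact_mod_cast (by omega : k ≤ 3 * m)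
  · rw [Finset.card_range, nsmul_eq_mul]
    push_cast
    gcongr
    linarith

lemma abs_polyIntegral_X_sub_C_mul_kernel_le {m : ℕ} (hm : 1 ≤ m) (α : ℝ) :
    |polyIntegral ((Polynomial.X - Polynomial.C (Real.cos α)) * kernel (3 * m) α)| ≤
      1000000 * (m : ℝ) ^ 6 := by
  have hm' : (1 : ℝ) ≤ m := by exact_mod_cast hm
  rw [polyIntegral_X_sub_C_mul_kernel, abs_mul]
  have h : |∑ k ∈ Finset.range (3 * m + 1),
      kernelCoeff (3 * m : ℕ) k * kernelEven (3 * m : ℕ) k| ≤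
      4 * m * (36 * (m : ℝ) ^ 3 * (60 * (m : ℝ) ^ 2)) := by
    refine (Finset.abs_sum_le_sum_abs _ _).trans
      (sum_range_le_of_forall_le hm (by positivity) fun k hk => ?_)
    have hk0 : (0 : ℝ) ≤ k := k.cast_nonneg
    push_cast
    rw [abs_mul, abs_of_nonneg (kernelCoeff_nonneg hk0 hk)]
    exact mul_le_mul (kernelCoeff_le hm' hk0 hk) (abs_kernelEven_le hm' hk0 hk) (abs_nonneg _)
      (by positivity)
  calc _ ≤ 1 * (4 * m * (36 * (m : ℝ) ^ 3 * (60 * (m : ℝ) ^ 2))) :=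
        mul_le_mul (Real.abs_cos_le_one α) h (abs_nonneg _) zero_le_one
    _ = 8640 * (m : ℝ) ^ 6 := by ring
    _ ≤ _ := by gcongr; norm_num

lemma polyIntegral_X_sub_C_sq_mul_kernel_le {m : ℕ} (hm : 1 ≤ m) (α : ℝ) :
    polyIntegral ((Polynomial.X - Polynomial.C (Real.cos α)) ^ 2 * kernel (3 * m) α) ≤
      1000000 * (m : ℝ) ^ 6 := by
  have hm' : (1 : ℝ) ≤ m := by exact_mod_cast hm
  rw [polyIntegral_X_sub_C_sq_mul_kernel]
  calc _ ≤ 4 * m * (7200 * (m : ℝ) ^ 5 + 93312 * (m : ℝ) ^ 5) := by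
        refine sum_range_le_of_forall_le hm (by positivity) fun k hk => ?_
        have hk0 : (0 : ℝ) ≤ k := k.cast_nonneg
        push_cast
        have hE := sq_le_sq' (abs_le.1 (abs_kernelEven_le hm' hk0 hk)).1
          (abs_le.1 (abs_kernelEven_le hm' hk0 hk)).2
        have hO := sq_le_sq' (abs_le.1 (abs_kernelOdd_le hm' hk0 hk)).1
          (abs_le.1 (abs_kernelOdd_le hm' hk0 hk)).2
        have hc : Real.cos α ^ 2 ≤ 1 := Real.cos_sq_le_one α
        have hs : Real.sin α ^ 2 ≤ 1 := Real.sin_sq_le_one α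
        rw [div_le_iff₀ (by positivity)]
        calc _ ≤ 1 * (60 * (m : ℝ) ^ 2) ^ 2 + 1 * (108 * (m : ℝ) ^ 2 * (k + 1)) ^ 2 := by
              gcongr
          _ = 3600 * (m : ℝ) ^ 4 + 11664 * (m : ℝ) ^ 4 * (k + 1) * (k + 1) := by ring
          _ ≤ 3600 * (m : ℝ) ^ 4 * m * (2 * k + 1) +
              11664 * (m : ℝ) ^ 4 * (4 * m) * (2 * k + 1) := by
              have h4 : (0 : ℝ) ≤ 3600 * (m : ℝ) ^ 4 := by positivity
              have h1 : (1 : ℝ) ≤ m * (2 * k + 1) := by nlinarith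
              rw [mul_assoc (3600 * (m : ℝ) ^ 4)]
              refine add_le_add (le_mul_of_one_le_right h4 h1) ?_
              gcongr <;> linarith
          _ ≤ _ := by
              have h5 : (0 : ℝ) ≤ (m : ℝ) ^ 5 * (k + 1 / 2) := by positivity
              nlinarith
    _ = 402048 * (m : ℝ) ^ 6 := by ring
    _ ≤ _ := by gcongr; norm_num

/-- Univariate sums of squares of degree `2d` with first and second moments about a given point of
`[-1, 1]` of order `1 / d ^ 2`. -/
lemma exists_kernel {a : ℝ} (ha : a ∈ Set.Icc (-1 : ℝ) 1) (d : ℕ) :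
    ∃ q : Polynomial ℝ, IsSumSq q ∧ q.natDegree ≤ 2 * d ∧ polyIntegral q = 1 ∧
      |polyIntegral ((Polynomial.X - Polynomial.C a) * q)| ≤ 36000000 / (d + 1 : ℝ) ^ 2 ∧
      polyIntegral ((Polynomial.X - Polynomial.C a) ^ 2 * q) ≤ 36000000 / (d + 1 : ℝ) ^ 2 := by
  rcases lt_or_ge d 3 with hd | hd
  · have hd' : (d : ℝ) ≤ 2 := by exact_mod_cast (by omega : d ≤ 2)
    have hbig : (2 : ℝ) ≤ 36000000 / (d + 1 : ℝ) ^ 2 := by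
      rw [le_div_iff₀ (by positivity)]
      have : (d + 1 : ℝ) ^ 2 ≤ (2 + 1) ^ 2 := by gcongr
      linarith
    have hone : polyIntegral 1 = 2 := by norm_num [polyIntegral_apply]
    have hX : polyIntegral Polynomial.X = 0 := by simp [polyIntegral_apply]
    have hX2 : polyIntegral (Polynomial.X ^ 2) = 2 / 3 := by norm_num [polyIntegral_apply]
    refine ⟨Polynomial.C (1 / 2), ?_, by simp, ?_, ?_, ?_⟩
    · have : (Polynomial.C (1 / 2) : Polynomial ℝ) =
          Polynomial.C (Real.sqrt (1 / 2)) * Polynomial.C (Real.sqrt (1 / 2)) := by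
        rw [← map_mul, Real.mul_self_sqrt (by norm_num)]
      rw [this]
      exact IsSumSq.mul_self _
    · rw [← mul_one (Polynomial.C (1 / 2 : ℝ)), polyIntegral_C_mul, hone]
      norm_num
    · rw [mul_comm, polyIntegral_C_mul, map_sub, hX, ← mul_one (Polynomial.C a),
        polyIntegral_C_mul, hone]
      refine le_trans ?_ hbig
      rw [abs_le]
      constructor <;> linarith [ha.1, ha.2]
    · have e : (Polynomial.X - Polynomial.C a) ^ 2 * Polynomial.C (1 / 2 : ℝ) =
          Polynomial.C (1 / 2 : ℝ) * (Polynomial.X ^ 2 - Polynomial.C (2 * a) * Polynomial.X +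
            Polynomial.C (a ^ 2) * 1) := by
        simp only [map_mul, map_pow, Polynomial.C_ofNat]
        ring
      rw [e, polyIntegral_C_mul, map_add, map_sub, polyIntegral_C_mul, polyIntegral_C_mul, hX, hX2,
        hone]
      refine le_trans ?_ hbig
      nlinarith [ha.1, ha.2]
  · set m := d / 3 with hmd
    have hm : 1 ≤ m := by omega
    have hm' : (1 : ℝ) ≤ m := by exact_mod_cast hm
    have hdm : (d + 1 : ℝ) ≤ 6 * m := by exact_mod_cast (by omega : d + 1 ≤ 6 * m)
    have hcos : Real.cos (Real.arccos a) = a := Real.cos_arccos ha.1 ha.2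
    set α := Real.arccos a
    set Z := polyIntegral (kernel (3 * m) α) with hZ
    have hZm : (m : ℝ) ^ 8 ≤ Z := le_polyIntegral_kernel hm α
    have hZ0 : 0 < Z := lt_of_lt_of_le (by positivity) hZm
    have hT1 := abs_polyIntegral_X_sub_C_mul_kernel_le hm α
    have hT2 := polyIntegral_X_sub_C_sq_mul_kernel_le hm α
    rw [hcos] at hT1 hT2
    have key : Z⁻¹ * (1000000 * (m : ℝ) ^ 6) ≤ 36000000 / (d + 1 : ℝ) ^ 2 := by
      rw [inv_mul_eq_div, div_le_div_iff₀ hZ0 (by positivity)]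
      calc 1000000 * (m : ℝ) ^ 6 * (d + 1) ^ 2 ≤ 1000000 * (m : ℝ) ^ 6 * (6 * m) ^ 2 := by gcongr
        _ = 36000000 * (m : ℝ) ^ 8 := by ring
        _ ≤ _ := by gcongr
    refine ⟨Polynomial.C Z⁻¹ * kernel (3 * m) α, ?_, ?_, ?_, ?_, ?_⟩
    · have : Polynomial.C Z⁻¹ = Polynomial.C (Real.sqrt Z⁻¹) * Polynomial.C (Real.sqrt Z⁻¹) := by
        rw [← map_mul, Real.mul_self_sqrt (inv_nonneg.2 hZ0.le)]
      rw [this]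
      exact (IsSumSq.mul_self _).mul ((IsSumSq.mul_self _).add (IsSumSq.mul_self _))
    · refine (Polynomial.natDegree_C_mul_le _ _).trans ?_
      refine (Polynomial.natDegree_add_le _ _).trans (max_le ?_ ?_) <;>
      · refine Polynomial.natDegree_mul_le.trans ?_
        refine (add_le_add (natDegree_kernelPoly_le _ _) (natDegree_kernelPoly_le _ _)).trans ?_
        omega
    · rw [polyIntegral_C_mul, ← hZ, inv_mul_cancel₀ hZ0.ne']
    · rw [mul_left_comm, polyIntegral_C_mul, abs_mul, abs_of_pos (inv_pos.2 hZ0)]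
      exact (mul_le_mul_of_nonneg_left hT1 (inv_pos.2 hZ0).le).trans key
    · rw [mul_left_comm, polyIntegral_C_mul]
      exact (mul_le_mul_of_nonneg_left hT2 (inv_pos.2 hZ0).le).trans key

lemma polyIntegral_nonneg {p : Polynomial ℝ} (hp : ∀ x ∈ Set.Icc (-1 : ℝ) 1, 0 ≤ p.eval x) :
    0 ≤ polyIntegral p :=
  intervalIntegral.integral_nonneg (by norm_num) hp

lemma IsSumSq.map {R S : Type*} [Semiring R] [Semiring S] (φ : R →+* S) {s : R}
    (hs : IsSumSq s) : IsSumSq (φ s) := by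
  induction hs with
  | zero => simp
  | sq_add a _ ih =>
    rw [map_add, map_mul]
    exact IsSumSq.sq_add _ ih

lemma IsSumSq.eval_nonneg {q : Polynomial ℝ} (hq : IsSumSq q) (x : ℝ) : 0 ≤ q.eval x :=
  (hq.map (Polynomial.evalRingHom x)).nonneg

lemma exists_X_pow_eq_taylor (a : ℝ) (e : ℕ) :
    ∃ (c : ℝ) (h : Polynomial ℝ), Polynomial.X ^ e = Polynomial.C (a ^ e) +
      Polynomial.C c * (Polynomial.X - Polynomial.C a) +
      (Polynomial.X - Polynomial.C a) ^ 2 * h := by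
  induction e with
  | zero => exact ⟨0, 0, by simp⟩
  | succ e ih =>
    obtain ⟨c, h, he⟩ := ih
    refine ⟨a ^ e + c * a, Polynomial.C c + Polynomial.X * h, ?_⟩
    rw [pow_succ, he]
    simp only [map_add, map_mul, map_pow]
    ring

/-- Moments of a kernel are controlled by its first two moments about a point. -/
lemma exists_abs_polyIntegral_X_pow_mul_sub_le (a : ℝ) (e : ℕ) :
    ∃ B : ℝ, ∀ (q : Polynomial ℝ) (ε : ℝ), IsSumSq q → polyIntegral q = 1 →
      |polyIntegral ((Polynomial.X - Polynomial.C a) * q)| ≤ ε →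
      polyIntegral ((Polynomial.X - Polynomial.C a) ^ 2 * q) ≤ ε →
      |polyIntegral (Polynomial.X ^ e * q) - a ^ e| ≤ B * ε := by
  obtain ⟨c, h, he⟩ := exists_X_pow_eq_taylor a e
  obtain ⟨B, hB⟩ := isCompact_Icc.exists_bound_of_continuousOn
    (s := Set.Icc (-1 : ℝ) 1) (f := fun x => h.eval x) h.continuous.continuousOn
  have hB0 : 0 ≤ B := (norm_nonneg _).trans (hB 0 (by norm_num))
  refine ⟨|c| + B, fun q ε hq hq1 h1 h2 => ?_⟩
  set D := Polynomial.X - Polynomial.C a with hD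
  have hexp : Polynomial.X ^ e * q = Polynomial.C (a ^ e) * q + Polynomial.C c * (D * q) +
      D ^ 2 * h * q := by
    rw [he]
    ring
  have hsq (x : ℝ) : 0 ≤ (D ^ 2 * q).eval x := by
    rw [Polynomial.eval_mul, Polynomial.eval_pow]
    exact mul_nonneg (sq_nonneg _) (hq.eval_nonneg x)
  have hlow : 0 ≤ polyIntegral (Polynomial.C B * (D ^ 2 * q) + D ^ 2 * h * q) := by
    refine polyIntegral_nonneg fun x hx => ?_
    have hh := neg_le_of_abs_le (hB x hx)
    have e : (Polynomial.C B * (D ^ 2 * q) + D ^ 2 * h * q).eval x =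
        (B + h.eval x) * (D ^ 2 * q).eval x := by
      simp only [Polynomial.eval_add, Polynomial.eval_mul, Polynomial.eval_C]
      ring
    rw [e]
    exact mul_nonneg (by linarith) (hsq x)
  have hupp : 0 ≤ polyIntegral (Polynomial.C B * (D ^ 2 * q) - D ^ 2 * h * q) := by
    refine polyIntegral_nonneg fun x hx => ?_
    have hh := le_of_abs_le (hB x hx)
    have e : (Polynomial.C B * (D ^ 2 * q) - D ^ 2 * h * q).eval x =
        (B - h.eval x) * (D ^ 2 * q).eval x := by
      simp only [Polynomial.eval_sub, Polynomial.eval_mul, Polynomial.eval_C]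
      ring
    rw [e]
    exact mul_nonneg (by linarith) (hsq x)
  rw [map_add, polyIntegral_C_mul] at hlow
  rw [map_sub, polyIntegral_C_mul] at hupp
  rw [hexp, map_add, map_add, polyIntegral_C_mul, polyIntegral_C_mul, hq1]
  have h3 : |c * polyIntegral (D * q)| ≤ |c| * ε := by
    rw [abs_mul]
    gcongr
  have h4 : B * polyIntegral (D ^ 2 * q) ≤ B * ε := by gcongr
  have h5 := abs_le.1 h3
  rw [abs_le]
  constructor <;> linarith

lemma setIntegral_prod_eval {n : ℕ} (g : Fin n → Polynomial ℝ) :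
    ∫ x in {x : EuclideanSpace ℝ (Fin n) | ∀ i, x i ∈ Set.Icc (-1 : ℝ) 1},
      ∏ i, (g i).eval (x i) = ∏ i, polyIntegral (g i) := by
  have hset : {x : EuclideanSpace ℝ (Fin n) | ∀ i, x i ∈ Set.Icc (-1 : ℝ) 1} =
      WithLp.ofLp ⁻¹' (Set.univ.pi fun _ => Set.Icc (-1 : ℝ) 1) := by
    ext x
    simp only [Set.mem_ofPred_eq, Set.mem_preimage, Set.mem_univ_pi]
  rw [hset, (PiLp.volume_preserving_ofLp (Fin n)).setIntegral_preimage_emb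
    (MeasurableEquiv.toLp 2 (Fin n → ℝ)).symm.measurableEmbedding
    (fun y => ∏ i, (g i).eval (y i)), volume_pi, Measure.restrict_pi_pi,
    integral_fintype_prod_eq_prod (fun i y => (g i).eval y)]
  refine Finset.prod_congr rfl fun i _ => ?_
  rw [polyIntegral_apply, intervalIntegral.integral_of_le (by norm_num), integral_Icc_eq_integral_Ioc]

/-- The tensor product of univariate polynomials. -/
def tensorPoly {n : ℕ} (q : Fin n → Polynomial ℝ) : MvPolynomial (Fin n) ℝ :=
  ∏ i, Polynomial.aeval (MvPolynomial.X i) (q i)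

lemma eval_tensorPoly {n : ℕ} (q : Fin n → Polynomial ℝ) (x : Fin n → ℝ) :
    MvPolynomial.eval x (tensorPoly q) = ∏ i, (q i).eval (x i) := by
  rw [tensorPoly, map_prod]
  refine Finset.prod_congr rfl fun i _ => ?_
  rw [← MvPolynomial.coe_aeval_eq_eval, RingHom.coe_coe, ← Polynomial.aeval_algHom_apply,
    MvPolynomial.aeval_X, Polynomial.coe_aeval_eq_eval]

lemma isSumSq_tensorPoly {n : ℕ} {q : Fin n → Polynomial ℝ} (hq : ∀ i, IsSumSq (q i)) :
    IsSumSq (tensorPoly q) :=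
  IsSumSq.prod fun i _ => (hq i).map (Polynomial.aeval (MvPolynomial.X i)).toRingHom

lemma totalDegree_tensorPoly_le {n : ℕ} {q : Fin n → Polynomial ℝ} {d : ℕ}
    (hq : ∀ i, (q i).natDegree ≤ d) : (tensorPoly q).totalDegree ≤ n * d := by
  refine (MvPolynomial.totalDegree_finsetProd _ _).trans ?_
  refine (Finset.sum_le_card_nsmul _ _ d fun i _ => ?_).trans (by simp)
  rw [Polynomial.aeval_eq_sum_range]
  refine MvPolynomial.totalDegree_finsetSum_le fun k hk => ?_
  refine (MvPolynomial.totalDegree_smul_le _ _).trans ?_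
  rw [MvPolynomial.totalDegree_X_pow]
  have := Finset.mem_range.1 hk
  have := hq i
  omega

lemma IsSumSq.isSOS {n : ℕ} {q : MvPolynomial (Fin n) ℝ} (hq : IsSumSq q) : IsSOS q := by
  induction hq with
  | zero => exact ⟨0, Fin.elim0, by simp⟩
  | sq_add a _ ih =>
    obtain ⟨m, p, rfl⟩ := ih
    exact ⟨m + 1, Fin.cons a p, by simp [Fin.sum_univ_succ, sq]⟩

lemma IsSOS.eval_nonneg {n : ℕ} {q : MvPolynomial (Fin n) ℝ} (hq : IsSOS q) (x : Fin n → ℝ) :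
    0 ≤ MvPolynomial.eval x q := by
  obtain ⟨m, p, rfl⟩ := hq
  rw [map_sum]
  exact Finset.sum_nonneg fun i _ => by rw [map_pow]; exact sq_nonneg _

lemma isCompact_cube (n : ℕ) :
    IsCompact {x : EuclideanSpace ℝ (Fin n) | ∀ i, x i ∈ Set.Icc (-1 : ℝ) 1} := by
  have h : {x : EuclideanSpace ℝ (Fin n) | ∀ i, x i ∈ Set.Icc (-1 : ℝ) 1} =
      EuclideanSpace.equiv (Fin n) ℝ ⁻¹' (Set.univ.pi fun _ => Set.Icc (-1 : ℝ) 1) := by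
    ext x
    simp only [Set.mem_ofPred_eq, Set.mem_preimage, Set.mem_univ_pi]
    rfl
  rw [h]
  exact (EuclideanSpace.equiv (Fin n) ℝ).toHomeomorph.isCompact_preimage.2
    (isCompact_univ_pi fun _ => isCompact_Icc)

lemma continuous_eval_euclidean {n : ℕ} (p : MvPolynomial (Fin n) ℝ) :
    Continuous fun x : EuclideanSpace ℝ (Fin n) => MvPolynomial.eval (fun i => x i) p :=
  (MvPolynomial.continuous_eval p).comp (by fun_prop)

lemma integrableOn_cube_eval {n : ℕ} (p : MvPolynomial (Fin n) ℝ) :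
    IntegrableOn (fun x : EuclideanSpace ℝ (Fin n) => MvPolynomial.eval (fun i => x i) p)
      {x : EuclideanSpace ℝ (Fin n) | ∀ i, x i ∈ Set.Icc (-1 : ℝ) 1} :=
  (continuous_eval_euclidean p).continuousOn.integrableOn_compact (isCompact_cube n)

open Asymptotics in
lemma isBigO_prod_sub_prod {ι X : Type*} {l : Filter X} {ε : X → ℝ}
    (hε : ε =O[l] fun _ => (1 : ℝ)) {M : ι → X → ℝ} {b : ι → ℝ}
    (h : ∀ i, (fun d => M i d - b i) =O[l] ε) (s : Finset ι) :
    (fun d => ∏ i ∈ s, M i d - ∏ i ∈ s, b i) =O[l] ε := by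
  classical
  induction s using Finset.induction_on with
  | empty => simpa using isBigO_zero _ _
  | insert j s hj ih =>
    have hM : M j =O[l] fun _ => (1 : ℝ) := by
      have := ((h j).trans hε).add (isBigO_const_const (b j) (one_ne_zero (α := ℝ)) l)
      simpa using this
    have h1 := hM.mul ih
    have h2 := (h j).mul (isBigO_const_const (∏ i ∈ s, b i) (one_ne_zero (α := ℝ)) l)
    simp only [one_mul] at h1
    simp only [mul_one] at h2
    refine (h1.add h2).congr_left fun d => ?_
    rw [Finset.prod_insert hj, Finset.prod_insert hj]
    ring

open Asymptotics in
/-- The product kernels reproduce the value of a polynomial at a point of the cube up to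
`O(1 / d ^ 2)`. -/
lemma isBigO_setIntegral_mul_tensorPoly_sub {n : ℕ} {a : Fin n → ℝ}
    {q : Fin n → ℕ → Polynomial ℝ} {ε : ℕ → ℝ} (hε : ε =O[⊤] fun _ => (1 : ℝ))
    (hq : ∀ i d, IsSumSq (q i d)) (hq1 : ∀ i d, polyIntegral (q i d) = 1)
    (h1 : ∀ i d, |polyIntegral ((Polynomial.X - Polynomial.C (a i)) * q i d)| ≤ ε d)
    (h2 : ∀ i d, polyIntegral ((Polynomial.X - Polynomial.C (a i)) ^ 2 * q i d) ≤ ε d)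
    (f : MvPolynomial (Fin n) ℝ) :
    (fun d => (∫ x in {x : EuclideanSpace ℝ (Fin n) | ∀ i, x i ∈ Set.Icc (-1 : ℝ) 1},
      MvPolynomial.eval (fun i => x i) f *
        MvPolynomial.eval (fun i => x i) (tensorPoly fun i => q i d)) -
      MvPolynomial.eval a f) =O[⊤] ε := by
  induction f using MvPolynomial.induction_on' with
  | monomial u c =>
    have hm (i : Fin n) :
        (fun d => polyIntegral (Polynomial.X ^ u i * q i d) - a i ^ u i) =O[⊤] ε := by
      obtain ⟨B, hB⟩ := exists_abs_polyIntegral_X_pow_mul_sub_le (a i) (u i)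
      refine isBigO_top.2 ⟨|B|, fun d => ?_⟩
      have := hB (q i d) (ε d) (hq i d) (hq1 i d) (h1 i d) (h2 i d)
      rw [Real.norm_eq_abs, Real.norm_eq_abs, ← abs_mul]
      exact this.trans (le_abs_self _)
    refine ((isBigO_prod_sub_prod hε hm Finset.univ).const_mul_left c).congr_left fun d => ?_
    have hint : ∫ x in {x : EuclideanSpace ℝ (Fin n) | ∀ i, x i ∈ Set.Icc (-1 : ℝ) 1},
        MvPolynomial.eval (fun i => x i) (MvPolynomial.monomial u c) *
          MvPolynomial.eval (fun i => x i) (tensorPoly fun i => q i d) =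
        c * ∏ i, polyIntegral (Polynomial.X ^ u i * q i d) := by
      rw [← setIntegral_prod_eval, ← integral_const_mul]
      refine integral_congr_ae (Filter.Eventually.of_forall fun x => ?_)
      simp only [MvPolynomial.eval_monomial, eval_tensorPoly, Polynomial.eval_mul,
        Polynomial.eval_pow, Polynomial.eval_X, Finset.prod_mul_distrib]
      rw [Finsupp.prod_fintype _ _ (by simp), mul_assoc]
    rw [hint, MvPolynomial.eval_monomial, Finsupp.prod_fintype _ _ (by simp)]
    ring
  | add f g hf hg =>
    refine (hf.add hg).congr_left fun d => ?_
    have hi (p : MvPolynomial (Fin n) ℝ) :=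
      integrableOn_cube_eval (p * tensorPoly fun i => q i d)
    simp only [map_mul] at hi
    simp only [map_add, add_mul]
    rw [integral_add (hi f) (hi g)]
    ring

lemma le_lasserre_integrand {n : ℕ} {f q : MvPolynomial (Fin n) ℝ} {m : ℝ}
    {K : Set (EuclideanSpace ℝ (Fin n))}
    (hK : K = {x : EuclideanSpace ℝ (Fin n) | ∀ i, x i ∈ Set.Icc (-1 : ℝ) 1})
    (hm : ∀ x ∈ K, m ≤ MvPolynomial.eval (fun i => x i) f) (hq : IsSOS q)
    (hq1 : ∫ x in K, MvPolynomial.eval (fun i => x i) q = 1) :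
    m ≤ ∫ x in K, MvPolynomial.eval (fun i => x i) f * MvPolynomial.eval (fun i => x i) q := by
  have hKm : MeasurableSet K := hK ▸ (isCompact_cube n).measurableSet
  calc m = ∫ x in K, m * MvPolynomial.eval (fun i => x i) q := by
        rw [integral_const_mul, hq1, mul_one]
    _ ≤ _ := by
        refine setIntegral_mono_on ?_ ?_ hKm fun x hx =>
          mul_le_mul_of_nonneg_right (hm x hx) (hq.eval_nonneg _)
        · exact hK ▸ (integrableOn_cube_eval q).const_mul m
        · have := integrableOn_cube_eval (f * q)
          simp only [map_mul] at this
          exact hK ▸ this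

/-- Theorem: for `K = [-1,1]^n` with the Lebesgue measure (weight `w ≡ 1`),
the Lasserre error of any polynomial `f` is `O(1/r²)`. -/
theorem stmt1 {n : ℕ}
    (K : Set (EuclideanSpace ℝ (Fin n)))
    (hK : K = {x : EuclideanSpace ℝ (Fin n) | ∀ i, x i ∈ Set.Icc (-1 : ℝ) 1})
    (f : MvPolynomial (Fin n) ℝ)
    (F : EuclideanSpace ℝ (Fin n) → ℝ)
    (hF : ∀ x : EuclideanSpace ℝ (Fin n), F x = MvPolynomial.eval (fun i => x i) f) :
    ∃ c : ℝ, 0 < c ∧ ∀ r : ℕ, 1 ≤ r →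
      lasserreError r K (fun _ => 1) F ≤ c / (r : ℝ) ^ 2 := by
  obtain ⟨a, haK, hamin⟩ := (hK ▸ isCompact_cube n : IsCompact K).exists_isMinOn
    (f := fun x : EuclideanSpace ℝ (Fin n) => MvPolynomial.eval (fun i => x i) f)
    (hK ▸ ⟨0, fun i => by simp⟩) (continuous_eval_euclidean f).continuousOn
  have ha (i : Fin n) : a i ∈ Set.Icc (-1 : ℝ) 1 := by
    rw [hK] at haK
    exact haK i
  have hmin : ∀ x ∈ K, MvPolynomial.eval (fun i => a i) f ≤ MvPolynomial.eval (fun i => x i) f :=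
    fun x hx => hamin hx
  have hF' : F = fun x => MvPolynomial.eval (fun i => x i) f := funext hF
  have hsInf : sInf (F '' K) = MvPolynomial.eval (fun i => a i) f := by
    refine IsLeast.csInf_eq ⟨⟨a, haK, hF a⟩, ?_⟩
    rintro _ ⟨x, hx, rfl⟩
    rw [hF]
    exact hmin x hx
  choose q hq hdeg hq1 h1 h2 using fun (i : Fin n) (d : ℕ) => exists_kernel (ha i) d
  have hε : (fun d : ℕ => 36000000 / (d + 1 : ℝ) ^ 2) =O[⊤] fun _ => (1 : ℝ) := by
    refine Asymptotics.isBigO_top.2 ⟨36000000, fun d => ?_⟩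
    rw [Real.norm_of_nonneg (by positivity), norm_one, mul_one]
    refine div_le_self (by norm_num) (one_le_pow₀ ?_)
    linarith [(d.cast_nonneg : (0 : ℝ) ≤ d)]
  obtain ⟨B, hB⟩ := Asymptotics.isBigO_top.1
    (isBigO_setIntegral_mul_tensorPoly_sub hε hq hq1 h1 h2 f)
  refine ⟨|B| * 36000000 * (n + 1) ^ 2 + 1, by positivity, fun r hr => ?_⟩
  have hr0 : (0 : ℝ) < r := by exact_mod_cast hr
  obtain ⟨d, hd1, hd2⟩ : ∃ d, n * d ≤ r ∧ r ≤ (n + 1) * (d + 1) := by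
    refine ⟨r / (n + 1), ?_, (Nat.lt_mul_div_succ r n.succ_pos).le⟩
    exact (Nat.mul_le_mul_right _ n.le_succ).trans (Nat.mul_div_le r (n + 1))
  have hd2' : (r : ℝ) ≤ (n + 1) * (d + 1) := by exact_mod_cast hd2
  have hsos := (isSumSq_tensorPoly fun i => hq i d).isSOS
  have hone : ∫ x in K, MvPolynomial.eval (fun i => x i) (tensorPoly fun i => q i d) = 1 := by
    simp only [eval_tensorPoly]
    rw [hK, setIntegral_prod_eval]
    exact Finset.prod_eq_one fun i _ => hq1 i d
  have hle : lasserre r K (fun _ => 1) F ≤ ∫ x in K, MvPolynomial.eval (fun i => x i) f *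
      MvPolynomial.eval (fun i => x i) (tensorPoly fun i => q i d) := by
    refine csInf_le ⟨MvPolynomial.eval (fun i => a i) f, ?_⟩
      ⟨tensorPoly fun i => q i d, hsos, ?_, by simpa using hone, by simp [hF]⟩
    · rintro _ ⟨p, hp, -, hp1, rfl⟩
      simp only [mul_one] at hp1
      simp only [mul_one, hF]
      exact le_lasserre_integrand hK hmin hp hp1
    · refine (totalDegree_tensorPoly_le fun i => hdeg i d).trans ?_
      calc n * (2 * d) = 2 * (n * d) := by ring
        _ ≤ 2 * r := by gcongr
  have hBd := (le_abs_self _).trans (hB d)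
  rw [← hK, Real.norm_of_nonneg (by positivity : (0 : ℝ) ≤ 36000000 / (d + 1 : ℝ) ^ 2)] at hBd
  rw [lasserreError, hsInf]
  calc _ ≤ B * (36000000 / (d + 1 : ℝ) ^ 2) := by linarith
    _ ≤ |B| * (36000000 / (d + 1 : ℝ) ^ 2) := by
        gcongr
        exact le_abs_self B
    _ ≤ |B| * 36000000 * (n + 1) ^ 2 / (r : ℝ) ^ 2 := by
        rw [mul_div_assoc', div_le_div_iff₀ (by positivity) (by positivity),
          mul_assoc _ (((n : ℝ) + 1) ^ 2), ← mul_pow]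
        gcongr
    _ ≤ _ := by gcongr; linarith
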